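/- Let Λ be a finite type, let d : Λ → ℕ assign to each s ∈ Λ a prime d(s), and let A = Matrix I I ℂ where I = Π s : Λ, Fin (d s), i.e., the ℂ-algebra of operators on the tensor product of qudits of dimensions d(s). For a subset S ⊆ Λ let P(S) ⊆ A be the ℂ-subalgebra of operators acting only on the coordinates in S (under the identification of I with (Π s ∈ S, Fin (d s)) × (Π s ∉ S, Fin (d s)), the matrices of the form N ⊗ Identity), and write P_s = P({s}). Suppose given a family (Q_s)_{s ∈ Λ} of ℂ-subalgebras of A, closed under star, and subsets S_s ⊆ Λ, such that: (a) Q_s ⊆ P(S_s) for every s; (b) each Q_s is isomorphic as a ℂ-algebra to the full matrix algebra Matrix (Fin r_s) (Fin r_s) ℂ for some prime r_s; (c) for s ≠ t, every element of Q_s commutes with every element of Q_t; and (d) the subalgebra of A generated by all the Q_s is all of A. Then there exist a bijection π : Λ → Λ and a ℂ-algebra automorphism β of A such that for every s ∈ Λ: π(s) ∈ S_s, d(π(s)) = r_s, and β maps P_{π(s)} onto Q_s. -/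

import Mathlib

/-! Statement 16 (marriage of commuting simple subalgebras): commuting simple subalgebras
of prime rank generating the full matrix algebra of a system of prime-dimensional qudits
are, after an automorphism, the single-qudit algebras of a system of matched qudits. -/

open scoped Classical

noncomputable section

/-- The set of operators supported on the subset `S` of qudits: matrices of the form
`N ⊗ Identity` with `N` acting on the coordinates in `S`. -/
def SuppOn {Λ : Type} (d : Λ → ℕ) (S : Set Λ) :
    Set (Matrix (∀ s : Λ, Fin (d s)) (∀ s : Λ, Fin (d s)) ℂ) :=
  { M | ∃ N : Matrix (∀ s : S, Fin (d s)) (∀ s : S, Fin (d s)) ℂ,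
      M = fun i j =>
        if ∀ s : Λ, s ∉ S → i s = j s then N (fun s => i s) (fun s => j s) else 0 }

namespace CommutingMatrixAlgebras

section OrderedProduct

variable {ι R B : Type*} [Fintype ι] [CommSemiring R] [Semiring B] [Algebra R B]

/-- The product of a finite family, in an arbitrary but fixed order, as a multilinear map. -/
def orderedProd (ι R B : Type*) [Fintype ι] [CommSemiring R] [Semiring B] [Algebra R B] :
    MultilinearMap R (fun _ : ι => B) B :=
  (MultilinearMap.mkPiAlgebraFin R (Fintype.card ι) B).domDomCongr (Fintype.equivFin ι).symm

theorem orderedProd_eq_noncommProd (f : ι → B)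
    (comm : ((Finset.univ : Finset ι) : Set ι).Pairwise (Function.onFun Commute f)) :
    orderedProd ι R B f = Finset.univ.noncommProd f comm := by
  classical
  set l := List.ofFn (Fintype.equivFin ι).symm with hl
  have hnd : l.Nodup := List.nodup_ofFn.2 (Equiv.injective _)
  have hlu : l.toFinset = Finset.univ := by
    ext i
    simpa [hl] using (Fintype.equivFin ι).symm.surjective i
  have h := Finset.noncommProd_toFinset l f (by rwa [hlu]) hnd
  rw [Finset.noncommProd_congr hlu.symm (fun _ _ => rfl), h, hl, List.map_ofFn]
  rfl

theorem orderedProd_one : orderedProd ι R B (fun _ => 1) = 1 := by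
  have comm : ((Finset.univ : Finset ι) : Set ι).Pairwise
      (Function.onFun Commute fun _ => (1 : B)) := fun _ _ _ _ _ => Commute.one_left _
  rw [orderedProd_eq_noncommProd _ comm,
    Finset.noncommProd_eq_pow_card _ _ _ 1 (fun _ _ => rfl), one_pow]

theorem orderedProd_mul (f g : ι → B) (hf : Pairwise fun i j => Commute (f i) (f j))
    (hg : Pairwise fun i j => Commute (g i) (g j))
    (hgf : Pairwise fun i j => Commute (g i) (f j)) :
    orderedProd ι R B (f * g) = orderedProd ι R B f * orderedProd ι R B g := by
  have hf' : ((Finset.univ : Finset ι) : Set ι).Pairwise (Function.onFun Commute f) :=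
    fun _ _ _ _ h => hf h
  have hg' : ((Finset.univ : Finset ι) : Set ι).Pairwise (Function.onFun Commute g) :=
    fun _ _ _ _ h => hg h
  rw [orderedProd_eq_noncommProd f hf', orderedProd_eq_noncommProd g hg',
    ← Finset.noncommProd_mul_distrib f g hf' hg' fun _ _ _ _ h => hgf h,
    orderedProd_eq_noncommProd]

theorem orderedProd_update_one [DecidableEq ι] (i : ι) (y : B) :
    orderedProd ι R B (Function.update 1 i y) = y := by
  have comm : ((Finset.univ : Finset ι) : Set ι).Pairwise
      (Function.onFun Commute (Function.update (1 : ι → B) i y)) := by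
    intro j _ k _ hjk
    rw [Function.onFun]
    rcases eq_or_ne j i with rfl | hj
    · simp [Function.update_of_ne hjk.symm]
    · simp [Function.update_of_ne hj]
  rw [orderedProd_eq_noncommProd _ comm,
    ← Finset.noncommProd_erase_mul _ (Finset.mem_univ i) _ comm
      (comm.mono fun _ _ => Finset.mem_univ _),
    Finset.noncommProd_eq_pow_card _ _ _ 1
      (fun j hj => by simp [Function.update_of_ne (Finset.ne_of_mem_erase hj)])]
  simp

end OrderedProduct

section TensorLift

variable {ι R B : Type*} [Fintype ι] [CommRing R] [Ring B] [Algebra R B]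
  {n : ι → Type*} [∀ i, DecidableEq (n i)]

/-- The Kronecker product of a finite family of matrices. -/
def piKronecker (x : ∀ i, Matrix (n i) (n i) R) : Matrix (∀ i, n i) (∀ i, n i) R :=
  Matrix.of fun a b => ∏ i, x i (a i) (b i)

theorem piKronecker_one :
    piKronecker (fun i => (1 : Matrix (n i) (n i) R)) = 1 := by
  ext a b
  by_cases h : a = b
  · subst h
    simp [piKronecker]
  · obtain ⟨i, hi⟩ := Function.ne_iff.1 h
    rw [Matrix.one_apply_ne h]
    exact Finset.prod_eq_zero (Finset.mem_univ i) (Matrix.one_apply_ne hi)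

theorem piKronecker_single (a b : ∀ i, n i) :
    piKronecker (fun i => Matrix.single (a i) (b i) (1 : R)) = Matrix.single a b 1 := by
  ext p q
  by_cases h : a = p ∧ b = q
  · obtain ⟨rfl, rfl⟩ := h
    simp [piKronecker]
  · rw [Matrix.single_apply_of_ne _ _ _ _ _ h]
    have : ∃ i, ¬(a i = p i ∧ b i = q i) := by
      by_contra! hc
      exact h ⟨funext fun i => (hc i).1, funext fun i => (hc i).2⟩
    obtain ⟨i, hi⟩ := this
    exact Finset.prod_eq_zero (Finset.mem_univ i) (Matrix.single_apply_of_ne _ _ _ _ _ hi)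

variable [DecidableEq ι] [∀ i, Fintype (n i)]

/-- The linear map sending each matrix unit of the product to the product of the images of the
matrix units of the factors. -/
def tensorLiftLinear (φ : ∀ i, Matrix (n i) (n i) R →ₐ[R] B) :
    Matrix (∀ i, n i) (∀ i, n i) R →ₗ[R] B :=
  ∑ a, ∑ b, (Matrix.entryLinearMap R R a b).smulRight
    (orderedProd ι R B fun i => φ i (Matrix.single (a i) (b i) 1))

theorem tensorLiftLinear_apply (φ : ∀ i, Matrix (n i) (n i) R →ₐ[R] B)
    (M : Matrix (∀ i, n i) (∀ i, n i) R) :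
    tensorLiftLinear φ M =
      ∑ a, ∑ b, M a b • orderedProd ι R B fun i => φ i (Matrix.single (a i) (b i) 1) := by
  simp [tensorLiftLinear]

theorem tensorLiftLinear_piKronecker (φ : ∀ i, Matrix (n i) (n i) R →ₐ[R] B)
    (x : ∀ i, Matrix (n i) (n i) R) :
    tensorLiftLinear φ (piKronecker x) = orderedProd ι R B fun i => φ i (x i) := by
  have h : (fun i => φ i (x i)) = fun i => ∑ p : n i × n i,
      x i p.1 p.2 • φ i (Matrix.single p.1 p.2 1) := by
    funext i
    conv_lhs => rw [Matrix.matrix_eq_sum_single (x i)]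
    simp only [map_sum, Fintype.sum_prod_type, ← map_smul, Matrix.smul_single, smul_eq_mul,
      mul_one]
  rw [h, MultilinearMap.map_sum, tensorLiftLinear_apply, ← Fintype.sum_prod_type',
    ← (Equiv.arrowProdEquivProdArrow ι n n).sum_comp]
  refine Finset.sum_congr rfl fun c _ => ?_
  rw [MultilinearMap.map_smul_univ]
  rfl

/-- Pairwise commuting homomorphisms from matrix algebras assemble to a homomorphism from the
matrix algebra on the product of the index types. -/
def tensorLift (φ : ∀ i, Matrix (n i) (n i) R →ₐ[R] B)
    (comm : Pairwise fun i j => ∀ x y, Commute (φ i x) (φ j y)) :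
    Matrix (∀ i, n i) (∀ i, n i) R →ₐ[R] B :=
  AlgHom.ofLinearMap (tensorLiftLinear φ)
    (by
      rw [← piKronecker_one, tensorLiftLinear_piKronecker]
      simp only [map_one]
      exact orderedProd_one)
    (by
      suffices H : (LinearMap.mul R _).compr₂ (tensorLiftLinear φ) =
          (LinearMap.mul R B).compl₁₂ (tensorLiftLinear φ) (tensorLiftLinear φ) from
        fun x y => LinearMap.congr_fun₂ H x y
      refine Matrix.ext_linearMap R fun a b => ?_
      refine LinearMap.ext_ring ?_
      refine Matrix.ext_linearMap R fun c e => ?_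
      refine LinearMap.ext_ring ?_
      have key : Matrix.single a b (1 : R) * Matrix.single c e 1 = piKronecker
          (fun i => Matrix.single (a i) (b i) (1 : R) * Matrix.single (c i) (e i) 1) := by
        by_cases h : b = c
        · subst h
          simp [piKronecker_single]
        · obtain ⟨i, hi⟩ := Function.ne_iff.1 h
          rw [Matrix.single_mul_single_of_ne _ _ _ _ h]
          ext p q
          refine (Finset.prod_eq_zero (Finset.mem_univ i) ?_).symm
          simp only [Matrix.single_mul_single_of_ne _ _ _ _ hi, Matrix.zero_apply]
      change tensorLiftLinear φ (Matrix.single a b 1 * Matrix.single c e 1) =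
        tensorLiftLinear φ (Matrix.single a b 1) * tensorLiftLinear φ (Matrix.single c e 1)
      rw [key, ← piKronecker_single, ← piKronecker_single, tensorLiftLinear_piKronecker,
        tensorLiftLinear_piKronecker, tensorLiftLinear_piKronecker,
        ← orderedProd_mul _ _ (fun i j h => comm h _ _) (fun i j h => comm h _ _)
          (fun i j h => comm h _ _)]
      simp only [map_mul]
      rfl)

theorem tensorLift_piKronecker_update (φ : ∀ i, Matrix (n i) (n i) R →ₐ[R] B)
    (comm : Pairwise fun i j => ∀ x y, Commute (φ i x) (φ j y)) (i : ι)
    (x : Matrix (n i) (n i) R) :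
    tensorLift φ comm (piKronecker (Function.update (fun _ => 1) i x)) = φ i x := by
  refine (tensorLiftLinear_piKronecker φ _).trans ?_
  rw [← orderedProd_update_one (R := R) i (φ i x)]
  congr 1
  funext j
  rcases eq_or_ne j i with rfl | hj
  · simp
  · simp [Function.update_of_ne hj]

end TensorLift

section Dimension

variable {K m n : Type*} [Field K] [Fintype m] [DecidableEq m] [Fintype n]
  [DecidableEq n]

theorem exists_trace_eq_natCast {E : Matrix n n K} (hE : IsIdempotentElem E) :
    ∃ k : ℕ, E.trace = k := by
  have h : IsIdempotentElem (Matrix.toLin' E) := by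
    rw [IsIdempotentElem, Module.End.mul_eq_comp, ← Matrix.toLin'_mul, hE.eq]
  refine ⟨Module.finrank K (LinearMap.range (Matrix.toLin' E)), ?_⟩
  rw [← Matrix.trace_toLin'_eq]
  exact (LinearMap.IsIdempotentElem.isProj_range _ h).trace

variable [CharZero K]

/-- The degree of a matrix algebra divides that of every matrix algebra it maps to. -/
theorem card_dvd_card_of_algHom (φ : Matrix m m K →ₐ[K] Matrix n n K) :
    Fintype.card m ∣ Fintype.card n := by
  rcases isEmpty_or_nonempty m with hm | ⟨⟨a⟩⟩
  · have h : (1 : Matrix n n K) = 0 := by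
      rw [← map_one φ, Subsingleton.elim (1 : Matrix m m K) 0, map_zero]
    have : IsEmpty n := by
      by_contra hn
      rw [not_isEmpty_iff] at hn
      exact one_ne_zero h
    simp
  obtain ⟨k, hk⟩ := exists_trace_eq_natCast
    (E := φ (Matrix.single a a 1)) (by simp [IsIdempotentElem, ← map_mul])
  have htr : ∀ b, (φ (Matrix.single b b 1)).trace = k := fun b => by
    rw [← hk]
    have h₁ : Matrix.single b b (1 : K) = Matrix.single b a 1 * Matrix.single a b 1 := by simp
    have h₂ : Matrix.single a a (1 : K) = Matrix.single a b 1 * Matrix.single b a 1 := by simp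
    rw [h₁, h₂, map_mul, map_mul, Matrix.trace_mul_comm]
  have h1 : (1 : Matrix m m K) = ∑ b, Matrix.single b b 1 := by
    rw [Matrix.sum_single_one]
  refine ⟨k, ?_⟩
  have h := congrArg (fun M => (φ M).trace) h1
  simp only [map_one, Matrix.trace_one, map_sum, Matrix.trace_sum, htr, Finset.sum_const,
    Finset.card_univ, nsmul_eq_mul] at h
  exact_mod_cast h

end Dimension

section Support

open scoped Kronecker

variable {Λ : Type} (d : Λ → ℕ)

theorem suppOn_mono {S T : Set Λ} (h : S ⊆ T) : SuppOn d S ⊆ SuppOn d T := by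
  rintro _ ⟨N, rfl⟩
  refine ⟨fun i j => if ∀ s : T, (s : Λ) ∉ S → i s = j s then
    N (fun s => i ⟨s, h s.2⟩) (fun s => j ⟨s, h s.2⟩) else 0, ?_⟩
  funext i j
  rw [← ite_and]
  refine if_congr ⟨fun H => ⟨fun s hs => H s fun h' => hs (h h'), fun s hs => H s hs⟩,
    fun H s hs => ?_⟩ rfl rfl
  by_cases hT : s ∈ T
  · exact H.2 ⟨s, hT⟩ hs
  · exact H.1 s hT

variable [Fintype Λ] [DecidableEq Λ]

/-- Tensoring an operator on the coordinates in `S` with the identity on the others. -/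
def suppEmb (S : Set Λ) :
    Matrix (∀ s : S, Fin (d s)) (∀ s : S, Fin (d s)) ℂ →ₐ[ℂ]
      Matrix (∀ s : Λ, Fin (d s)) (∀ s : Λ, Fin (d s)) ℂ :=
  AlgHom.ofLinearMap
    { toFun := fun N => (N ⊗ₖ 1).submatrix
        (Equiv.piEquivPiSubtypeProd (· ∈ S) fun s => Fin (d s))
        (Equiv.piEquivPiSubtypeProd (· ∈ S) fun s => Fin (d s))
      map_add' := fun M N => by
        rw [Matrix.add_kronecker]
        rfl
      map_smul' := fun c N => by
        rw [Matrix.smul_kronecker]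
        rfl }
    (by
      change (1 ⊗ₖ 1).submatrix _ _ = _
      rw [Matrix.one_kronecker_one, Matrix.submatrix_one_equiv])
    (fun M N => by
      change (_ ⊗ₖ 1).submatrix _ _ = (_ ⊗ₖ 1).submatrix _ _ *
        (_ ⊗ₖ 1).submatrix _ _
      rw [Matrix.submatrix_mul_equiv, ← Matrix.mul_kronecker_mul, Matrix.one_mul])

theorem suppEmb_apply (S : Set Λ) (N : Matrix (∀ s : S, Fin (d s)) (∀ s : S, Fin (d s)) ℂ) :
    suppEmb d S N = fun i j =>
      if ∀ s : Λ, s ∉ S → i s = j s then N (fun s => i s) (fun s => j s) else 0 := by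
  funext i j
  change N (fun s => i s) (fun s => j s) *
    (1 : Matrix (∀ s : {s // s ∉ S}, Fin (d s)) (∀ s : {s // s ∉ S}, Fin (d s)) ℂ)
      (fun s => i s) (fun s => j s) = _
  rw [Matrix.one_apply, mul_ite, mul_one, mul_zero]
  refine if_congr ?_ rfl rfl
  simp [funext_iff]

theorem coe_range_suppEmb (S : Set Λ) :
    ((suppEmb d S).range : Set (Matrix (∀ s : Λ, Fin (d s)) (∀ s : Λ, Fin (d s)) ℂ)) =
      SuppOn d S := by
  ext M
  simp only [AlgHom.coe_range, Set.mem_range, SuppOn, Set.mem_ofPred_eq, suppEmb_apply]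
  constructor <;> rintro ⟨N, rfl⟩ <;> exact ⟨N, by congr!⟩

theorem suppEmb_injective (hd : ∀ s, d s ≠ 0) (S : Set Λ) :
    Function.Injective (suppEmb d S) := by
  have : ∀ s, NeZero (d s) := fun s => ⟨hd s⟩
  exact (suppEmb d S).toRingHom.injective

theorem suppEmb_singleton (t : Λ)
    (N : Matrix (∀ s : ({t} : Set Λ), Fin (d s)) (∀ s : ({t} : Set Λ), Fin (d s)) ℂ) :
    suppEmb d {t} N = piKronecker (Function.update (fun _ => 1) t
      (N.submatrix (fun k s => Fin.cast (by rw [s.2]) k)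
        (fun k s => Fin.cast (by rw [s.2]) k))) := by
  have hrestr : ∀ i : ∀ s, Fin (d s),
      (fun s : ({t} : Set Λ) => Fin.cast (by rw [s.2]) (i t)) = fun s : ({t} : Set Λ) => i s := by
    intro i
    funext ⟨s, hs⟩
    obtain rfl : s = t := hs
    rfl
  rw [suppEmb_apply]
  funext i j
  rw [piKronecker, Matrix.of_apply, ← Finset.mul_prod_erase _ _ (Finset.mem_univ t),
    Function.update_self, Matrix.submatrix_apply, hrestr, hrestr]
  split_ifs with h
  · rw [Finset.prod_eq_one, mul_one]
    intro s hs
    have hst := Finset.ne_of_mem_erase hs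
    rw [Function.update_of_ne hst, h s hst, Matrix.one_apply_eq]
  · push Not at h
    obtain ⟨s, hs, hne⟩ := h
    rw [Finset.prod_eq_zero (Finset.mem_erase.2 ⟨hs, Finset.mem_univ s⟩), mul_zero]
    rw [Function.update_of_ne hs, Matrix.one_apply_ne hne]

theorem piKronecker_update_mem_suppOn (t : Λ) (x : Matrix (Fin (d t)) (Fin (d t)) ℂ) :
    piKronecker (Function.update (fun s => (1 : Matrix (Fin (d s)) (Fin (d s)) ℂ)) t x) ∈
      SuppOn d {t} := by
  rw [← coe_range_suppEmb]
  refine ⟨x.submatrix (fun k => k ⟨t, rfl⟩) (fun k => k ⟨t, rfl⟩), ?_⟩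
  exact suppEmb_singleton d t _

theorem image_tensorLift_suppOn_singleton {B : Type*} [Ring B] [Algebra ℂ B]
    (φ : ∀ t, Matrix (Fin (d t)) (Fin (d t)) ℂ →ₐ[ℂ] B)
    (comm : Pairwise fun s t => ∀ x y, Commute (φ s x) (φ t y)) (t : Λ) :
    tensorLift φ comm '' SuppOn d {t} = Set.range (φ t) := by
  ext b
  constructor
  · rintro ⟨M, hM, rfl⟩
    rw [← coe_range_suppEmb] at hM
    obtain ⟨N, rfl⟩ := hM
    exact ⟨_, (tensorLift_piKronecker_update φ comm t _).symm.trans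
      (congrArg _ (suppEmb_singleton d t N).symm)⟩
  · rintro ⟨x, rfl⟩
    exact ⟨_, piKronecker_update_mem_suppOn d t x, tensorLift_piKronecker_update φ comm t x⟩

theorem prod_dvd_prod_of_commute (hd : ∀ s, d s ≠ 0) {ι : Type*} (r : ι → ℕ)
    (φ : ∀ i, Matrix (Fin (r i)) (Fin (r i)) ℂ →ₐ[ℂ]
      Matrix (∀ s : Λ, Fin (d s)) (∀ s : Λ, Fin (d s)) ℂ)
    (comm : Pairwise fun i j => ∀ x y, Commute (φ i x) (φ j y))
    (J : Finset ι) (U : Set Λ) (hU : ∀ i ∈ J, ∀ x, φ i x ∈ SuppOn d U) :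
    ∏ i ∈ J, r i ∣ ∏ t ∈ U.toFinset, d t := by
  let e := AlgEquiv.ofInjective (suppEmb d U) (suppEmb_injective d hd U)
  have hmem : ∀ (i : J) x, φ i x ∈ (suppEmb d U).range := fun i x => by
    rw [← SetLike.mem_coe, coe_range_suppEmb]
    exact hU i i.2 x
  let ψ : ∀ i : J, Matrix (Fin (r i)) (Fin (r i)) ℂ →ₐ[ℂ]
      Matrix (∀ s : U, Fin (d s)) (∀ s : U, Fin (d s)) ℂ := fun i =>
    e.symm.toAlgHom.comp ((φ i).codRestrict _ (hmem i))
  have hψ : Pairwise fun i j => ∀ x y, Commute (ψ i x) (ψ j y) := fun i j hij x y => by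
    refine Commute.map (f := e.symm) ?_
    exact Subtype.ext (comm (fun h => hij (Subtype.ext h)) x y)
  have h := card_dvd_card_of_algHom (tensorLift ψ hψ)
  simp only [Fintype.card_pi, Fintype.card_fin] at h
  rwa [← Finset.prod_coe_sort J r, ← Finset.prod_set_coe]

end Support

section Matching

theorem le_card_filter_of_pow_dvd_prod {α : Type*} {d : α → ℕ} (hd : ∀ t, (d t).Prime)
    {p k : ℕ} (hp : p.Prime) {U : Finset α} (h : p ^ k ∣ ∏ t ∈ U, d t) :
    k ≤ (U.filter fun t => d t = p).card := by
  rw [hp.pow_dvd_iff_le_factorization (Finset.prod_ne_zero_iff.2 fun t _ => (hd t).ne_zero),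
    Nat.factorization_prod_apply fun t _ => (hd t).ne_zero] at h
  refine h.trans_eq ?_
  rw [Finset.card_filter]
  refine Finset.sum_congr rfl fun t _ => ?_
  rw [(hd t).factorization, Finsupp.single_apply]

/-- Hall's condition for prime labels, in terms of divisibility of products of labels. -/
theorem exists_equiv_of_prod_dvd_prod {Λ : Type*} [Fintype Λ] {d r : Λ → ℕ}
    (hd : ∀ s, (d s).Prime) (hr : ∀ s, (r s).Prime) (S : Λ → Set Λ)
    (h : ∀ J U : Finset Λ, (∀ s ∈ J, S s ⊆ U) → ∏ s ∈ J, r s ∣ ∏ t ∈ U, d t) :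
    ∃ π : Λ ≃ Λ, ∀ s, π s ∈ S s ∧ d (π s) = r s := by
  have hall : ∀ J : Finset Λ, J.card ≤
      (J.biUnion fun s => Finset.univ.filter fun t => t ∈ S s ∧ d t = r s).card := by
    intro J
    set N := J.biUnion fun s => Finset.univ.filter fun t => t ∈ S s ∧ d t = r s with hN
    rw [Finset.card_eq_sum_card_fiberwise (f := r) (s := J)
        (t := Finset.univ.image r ∪ Finset.univ.image d) (fun s _ => by simp),
      Finset.card_eq_sum_card_fiberwise (f := d) (s := N)
        (t := Finset.univ.image r ∪ Finset.univ.image d) (fun s _ => by simp)]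
    refine Finset.sum_le_sum fun p hp => ?_
    have hp : p.Prime := by
      simp only [Finset.mem_union, Finset.mem_image, Finset.mem_univ, true_and] at hp
      rcases hp with ⟨s, rfl⟩ | ⟨s, rfl⟩
      exacts [hr s, hd s]
    have hdvd := h (J.filter fun s => r s = p)
      (Finset.univ.filter fun t => ∃ s ∈ J, r s = p ∧ t ∈ S s)
      (fun s hs t ht => by
        simp only [Finset.mem_filter] at hs
        simpa using ⟨s, hs.1, hs.2, ht⟩)
    rw [Finset.prod_congr rfl fun s hs => (Finset.mem_filter.1 hs).2, Finset.prod_const] at hdvd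
    refine (le_card_filter_of_pow_dvd_prod hd hp hdvd).trans (Finset.card_le_card ?_)
    intro t ht
    simp only [Finset.mem_filter, Finset.mem_univ, true_and] at ht
    obtain ⟨⟨s, hs, hrs, hts⟩, hdt⟩ := ht
    simp only [hN, Finset.mem_filter, Finset.mem_biUnion, Finset.mem_univ, true_and]
    exact ⟨⟨s, hs, hts, hdt.trans hrs.symm⟩, hdt⟩
  obtain ⟨f, hf, hfS⟩ := (Finset.all_card_le_biUnion_card_iff_exists_injective _).1 hall
  exact ⟨Equiv.ofBijective f (Finite.injective_iff_bijective.1 hf), fun s => by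
    simpa using hfS s⟩

end Matching

end CommutingMatrixAlgebras

theorem automorphism_matching_commuting_simple_subalgebras
    (Λ : Type) [Fintype Λ] [DecidableEq Λ]
    (d : Λ → ℕ) (hd : ∀ s, (d s).Prime)
    (Q : Λ → Subalgebra ℂ (Matrix (∀ s : Λ, Fin (d s)) (∀ s : Λ, Fin (d s)) ℂ))
    (hstar : ∀ s, ∀ x ∈ Q s, star x ∈ Q s)
    (S : Λ → Set Λ)
    (r : Λ → ℕ) (hr : ∀ s, (r s).Prime)
    (hsupp : ∀ s, (Q s : Set (Matrix (∀ t : Λ, Fin (d t)) (∀ t : Λ, Fin (d t)) ℂ)) ⊆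
      SuppOn d (S s))
    (hsimple : ∀ s, Nonempty ((Q s) ≃ₐ[ℂ] Matrix (Fin (r s)) (Fin (r s)) ℂ))
    (hcomm : ∀ s t, s ≠ t → ∀ a ∈ Q s, ∀ b ∈ Q t, a * b = b * a)
    (hgen : Algebra.adjoin ℂ (⋃ s, (Q s : Set (Matrix (∀ t : Λ, Fin (d t))
      (∀ t : Λ, Fin (d t)) ℂ))) = ⊤) :
    ∃ (π : Λ ≃ Λ)
      (β : Matrix (∀ s : Λ, Fin (d s)) (∀ s : Λ, Fin (d s)) ℂ ≃ₐ[ℂ]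
        Matrix (∀ s : Λ, Fin (d s)) (∀ s : Λ, Fin (d s)) ℂ),
      ∀ s : Λ, π s ∈ S s ∧ d (π s) = r s ∧
        β '' SuppOn d {π s} =
          (Q s : Set (Matrix (∀ t : Λ, Fin (d t)) (∀ t : Λ, Fin (d t)) ℂ)) := by
  have e : ∀ s, Matrix (Fin (r s)) (Fin (r s)) ℂ ≃ₐ[ℂ] Q s := fun s => (hsimple s).some.symm
  have comm : Pairwise fun s t => ∀ x y,
      Commute ((Q s).val.comp (e s).toAlgHom x) ((Q t).val.comp (e t).toAlgHom y) :=
    fun s t hst x y => hcomm s t hst _ (e s x).2 _ (e t y).2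
  obtain ⟨π, hπ⟩ := CommutingMatrixAlgebras.exists_equiv_of_prod_dvd_prod hd hr S
    fun J U hU => by
      simpa using CommutingMatrixAlgebras.prod_dvd_prod_of_commute d (fun s => (hd s).ne_zero) r
        (fun s => (Q s).val.comp (e s).toAlgHom) comm J U fun s hs x =>
          CommutingMatrixAlgebras.suppOn_mono d (hU s hs) (hsupp s (e s x).2)
  have hdim : ∀ t, d t = r (π.symm t) := fun t => by
    simpa using (hπ (π.symm t)).2
  let φ : ∀ t, Matrix (Fin (d t)) (Fin (d t)) ℂ →ₐ[ℂ]
      Matrix (∀ s : Λ, Fin (d s)) (∀ s : Λ, Fin (d s)) ℂ := fun t =>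
    ((Q (π.symm t)).val.comp (e (π.symm t)).toAlgHom).comp
      (Matrix.reindexAlgEquiv ℂ ℂ (finCongr (hdim t))).toAlgHom
  have hφ : Pairwise fun s t => ∀ x y, Commute (φ s x) (φ t y) := fun s t hst x y =>
    comm (π.symm.injective.ne hst) _ _
  have hrange : ∀ t, Set.range (φ t) = Q (π.symm t) := fun t => by
    have hsurj := (e (π.symm t)).surjective.comp
      (Matrix.reindexAlgEquiv ℂ ℂ (finCongr (hdim t))).surjective
    exact (hsurj.range_comp Subtype.val).trans Subtype.range_coe
  have : ∀ s, NeZero (d s) := fun s => ⟨(hd s).ne_zero⟩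
  let β := CommutingMatrixAlgebras.tensorLift φ hφ
  have hβ : Function.Injective β.toLinearMap := β.injective
  refine ⟨π, AlgEquiv.ofBijective β ⟨hβ, LinearMap.injective_iff_surjective.1 hβ⟩,
    fun s => ⟨(hπ s).1, (hπ s).2, ?_⟩⟩
  refine (CommutingMatrixAlgebras.image_tensorLift_suppOn_singleton d φ hφ (π s)).trans ?_
  rw [hrange, π.symm_apply_apply]
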